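/- There exist a universal constant c′ > 0 and a threshold ρ₀ > 0 such that for every 0 < ρ ≤ ρ₀ the population EM operator is a contraction toward θ̄ on the ball B(θ̄, |θ̄|/4): for all θ ∈ B(θ̄, |θ̄|/4), |M(θ) − θ̄| ≤ γ |θ − θ̄|, where γ = e^{−c′ ξ²} and ξ = |θ*|. -/

import Mathlib

open MeasureTheory

noncomputable section

/-- Standard normal density `φ`. -/
def stdPdf (x : ℝ) : ℝ := (Real.sqrt (2 * Real.pi))⁻¹ * Real.exp (-x ^ 2 / 2)

/-- True density: three-component Gaussian mixture with unit variances,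
`g*(x) = (1/4)φ(x − θ*(−ρ−1)) + (1/2)φ(x − θ*) + (1/4)φ(x − θ*(ρ−1))`. -/
def gstar (θs ρ x : ℝ) : ℝ :=
  (1 / 4) * stdPdf (x - θs * (-ρ - 1)) + (1 / 2) * stdPdf (x - θs)
    + (1 / 4) * stdPdf (x - θs * (ρ - 1))

/-- Fitted two-component symmetric model `g_θ(x) = (1/2)φ(x−θ) + (1/2)φ(x+θ)`. -/
def gmod (θ x : ℝ) : ℝ := (1 / 2) * stdPdf (x - θ) + (1 / 2) * stdPdf (x + θ)

/-- The probability measure on `ℝ` with Lebesgue density `g*`. -/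
def gstarMeasure (θs ρ : ℝ) : Measure ℝ :=
  volume.withDensity fun x => ENNReal.ofReal (gstar θs ρ x)

/-- Kullback–Leibler divergence `KL(g* ‖ g_θ)` between the measures with Lebesgue
densities `g*` and `g_θ`. -/
def klg (θs ρ θ : ℝ) : ℝ := ∫ x, gstar θs ρ x * Real.log (gstar θs ρ x / gmod θ x)

/-- Population EM operator `M(θ) = E_{X ∼ g*}[X tanh(θ X)]`. -/
def Mpop (θs ρ θ : ℝ) : ℝ := ∫ x, x * Real.tanh (θ * x) ∂(gstarMeasure θs ρ)

lemma aux_cosh_le {l t : ℝ} (h : l ^ 2 ≤ 2 * t ^ 2) (x : ℝ) :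
    Real.cosh (l * x) ≤ Real.cosh (t * x) ^ 2 := by
  have h2 : Real.cosh (t * x) ^ 2 = 1 / 2 + 1 / 2 * Real.cosh (2 * (t * x)) := by
    rw [Real.cosh_two_mul]
    have := Real.cosh_sq (t * x)
    linarith
  rw [h2]
  have hs1 := Real.hasSum_cosh (l * x)
  have hs2 := (hasSum_ite_eq (0 : ℕ) (1 / 2 : ℝ)).add
    ((Real.hasSum_cosh (2 * (t * x))).mul_left (1 / 2))
  refine hasSum_le (fun n => ?_) hs1 hs2
  rcases Nat.eq_zero_or_pos n with rfl | hn
  · norm_num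
  · rw [if_neg hn.ne', zero_add, ← mul_div_assoc]
    gcongr
    rw [pow_mul, pow_mul]
    have h3 : (l * x) ^ 2 ≤ 2 * (t * x) ^ 2 := by
      rw [mul_pow, mul_pow]; nlinarith [sq_nonneg x]
    calc ((l * x) ^ 2) ^ n ≤ (2 * (t * x) ^ 2) ^ n := by gcongr
      _ = 2 ^ n * ((t * x) ^ 2) ^ n := by rw [mul_pow]
      _ ≤ (1 / 2 * 4 ^ n) * ((t * x) ^ 2) ^ n := by
        gcongr
        have h4 : (4 : ℝ) ^ n = 2 ^ n * 2 ^ n := by rw [← mul_pow]; norm_num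
        have h5 : (2 : ℝ) ≤ 2 ^ n := by
          calc (2 : ℝ) = 2 ^ 1 := by norm_num
            _ ≤ 2 ^ n := pow_le_pow_right₀ (by norm_num) hn
        rw [h4]; nlinarith
      _ = 1 / 2 * ((2 * (t * x)) ^ 2) ^ n := by
        rw [mul_pow 2 (t * x) 2, mul_pow _ _ n]; norm_num; ring

lemma aux_sinh_le {d : ℝ} (hd : 0 ≤ d) : Real.sinh d ≤ d * Real.cosh d := by
  have h : ∀ x ∈ interior (Set.Ici (0:ℝ)), 0 ≤ deriv (fun y => y * Real.cosh y - Real.sinh y) x := by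
    intro x hx
    rw [interior_Ici] at hx
    have h1 : HasDerivAt (fun y => y * Real.cosh y - Real.sinh y)
        (1 * Real.cosh x + x * Real.sinh x - Real.cosh x) x :=
      ((hasDerivAt_id x).mul (Real.hasDerivAt_cosh x)).sub (Real.hasDerivAt_sinh x)
    rw [h1.deriv]
    have := mul_nonneg (le_of_lt hx) (Real.sinh_nonneg_iff.2 (le_of_lt hx))
    linarith
  have hm := monotoneOn_of_deriv_nonneg (convex_Ici (0:ℝ))
    (by fun_prop) (by fun_prop) h
  have := hm (Set.mem_Ici.2 le_rfl) (Set.mem_Ici.2 hd) hd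
  simp at this
  linarith

lemma aux_tanh_sub {a b : ℝ} :
    Real.tanh b - Real.tanh a = Real.sinh (b - a) / (Real.cosh a * Real.cosh b) := by
  rw [Real.tanh_eq_sinh_div_cosh, Real.tanh_eq_sinh_div_cosh, Real.sinh_sub]
  have := (Real.cosh_pos a).ne'
  have := (Real.cosh_pos b).ne'
  field_simp

lemma aux_tanh_mono {a b : ℝ} (h : a ≤ b) : Real.tanh a ≤ Real.tanh b := by
  have : 0 ≤ Real.tanh b - Real.tanh a := by
    rw [aux_tanh_sub]
    have := Real.sinh_nonneg_iff.2 (sub_nonneg.2 h)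
    have := Real.cosh_pos a
    have := Real.cosh_pos b
    positivity
  linarith

lemma aux_tanh_sub_le {a b : ℝ} (ha : 0 ≤ a) (h : a ≤ b) :
    Real.tanh b - Real.tanh a ≤ (b - a) / Real.cosh a ^ 2 := by
  have ca := Real.cosh_pos a
  have cb := Real.cosh_pos b
  rw [aux_tanh_sub, div_le_div_iff₀ (by positivity) (by positivity)]
  have h1 := aux_sinh_le (sub_nonneg.2 h)
  have h2 : Real.cosh b = Real.cosh a * Real.cosh (b - a) + Real.sinh a * Real.sinh (b - a) := by
    rw [← Real.cosh_add]; congr 1; ring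
  have h3 : Real.cosh a * Real.cosh (b - a) ≤ Real.cosh b := by
    have := mul_nonneg (Real.sinh_nonneg_iff.2 ha) (Real.sinh_nonneg_iff.2 (sub_nonneg.2 h))
    linarith
  have hd : 0 ≤ b - a := sub_nonneg.2 h
  calc Real.sinh (b - a) * Real.cosh a ^ 2
      ≤ ((b - a) * Real.cosh (b - a)) * Real.cosh a ^ 2 := by gcongr
    _ = (b - a) * (Real.cosh a * (Real.cosh a * Real.cosh (b - a))) := by ring
    _ ≤ (b - a) * (Real.cosh a * Real.cosh b) := by gcongr

lemma aux_tanh_ratio {s t : ℝ} (hs : 0 ≤ s) (h : s ≤ t) :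
    s * Real.tanh t ≤ t * Real.tanh s := by
  have h1 := aux_tanh_sub_le hs h
  have cs := Real.cosh_pos s
  have h2 : s / Real.cosh s ^ 2 ≤ Real.tanh s := by
    rw [Real.tanh_eq_sinh_div_cosh, div_le_div_iff₀ (by positivity) cs]
    have := Real.self_le_sinh_iff.2 hs
    have h1c := Real.one_le_cosh s
    have : s * 1 ≤ Real.sinh s * Real.cosh s := by gcongr
    nlinarith
  have e : (t - s) / Real.cosh s ^ 2 * s = (t - s) * (s / Real.cosh s ^ 2) := by ring
  nlinarith [mul_le_mul_of_nonneg_left h2 (sub_nonneg.2 h), mul_le_mul_of_nonneg_right h1 hs]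

lemma aux_xtanh_even (θ x : ℝ) : -x * Real.tanh (θ * -x) = x * Real.tanh (θ * x) := by
  rw [mul_neg, Real.tanh_neg]; ring

lemma aux_xtanh_abs (θ x : ℝ) : |x| * Real.tanh (θ * |x|) = x * Real.tanh (θ * x) := by
  rcases abs_cases x with ⟨h, _⟩ | ⟨h, _⟩ <;> rw [h]
  exact aux_xtanh_even θ x

lemma aux_pt_mono {a b : ℝ} (h : a ≤ b) (x : ℝ) :
    x * Real.tanh (a * x) ≤ x * Real.tanh (b * x) := by
  rw [← aux_xtanh_abs a, ← aux_xtanh_abs b]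
  have := abs_nonneg x
  gcongr
  exact aux_tanh_mono (by gcongr)

lemma aux_pt_sub {a b : ℝ} (ha : 0 ≤ a) (h : a ≤ b) (x : ℝ) :
    x * Real.tanh (b * x) - x * Real.tanh (a * x) ≤ (b - a) * x ^ 2 / Real.cosh (a * x) ^ 2 := by
  rw [← aux_xtanh_abs a, ← aux_xtanh_abs b, ← mul_sub]
  have hx := abs_nonneg x
  have h1 := aux_tanh_sub_le (a := a * |x|) (b := b * |x|) (by positivity) (by gcongr)
  have h2 : Real.cosh (a * |x|) = Real.cosh (a * x) := by
    rw [← Real.cosh_abs (a * x), abs_mul, abs_of_nonneg ha]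
  rw [h2] at h1
  calc |x| * (Real.tanh (b * |x|) - Real.tanh (a * |x|))
      ≤ |x| * ((b * |x| - a * |x|) / Real.cosh (a * x) ^ 2) := by gcongr
    _ = (b - a) * |x| ^ 2 / Real.cosh (a * x) ^ 2 := by ring
    _ = _ := by rw [sq_abs]

lemma aux_pt_ratio {a b : ℝ} (ha : 0 ≤ a) (h : a ≤ b) (x : ℝ) :
    a * (x * Real.tanh (b * x)) ≤ b * (x * Real.tanh (a * x)) := by
  rw [← aux_xtanh_abs a, ← aux_xtanh_abs b]
  have hx := abs_nonneg x
  have h1 := aux_tanh_ratio (s := a * |x|) (t := b * |x|) (by positivity) (by gcongr)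
  nlinarith

lemma aux_logcosh (a b : ℝ) :
    (b - a) * Real.tanh a ≤ Real.log (Real.cosh b) - Real.log (Real.cosh a) := by
  have ca := Real.cosh_pos a
  have cb := Real.cosh_pos b
  rw [← Real.log_div cb.ne' ca.ne', Real.le_log_iff_exp_le (by positivity)]
  have t1 := Real.tanh_lt_one a
  have t2 := Real.neg_one_lt_tanh a
  have hc := convexOn_exp.2 (Set.mem_univ (b - a)) (Set.mem_univ (-(b - a)))
    (show 0 ≤ (1 + Real.tanh a) / 2 by linarith) (show 0 ≤ (1 - Real.tanh a) / 2 by linarith)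
    (by ring)
  simp only [smul_eq_mul] at hc
  have e1 : (1 + Real.tanh a) / 2 * (b - a) + (1 - Real.tanh a) / 2 * -(b - a)
    = (b - a) * Real.tanh a := by ring
  rw [e1] at hc
  refine hc.trans (le_of_eq ?_)
  have e2 : Real.cosh b = Real.cosh a * Real.cosh (b - a) + Real.sinh a * Real.sinh (b - a) := by
    rw [← Real.cosh_add]; congr 1; ring
  have e3 : Real.sinh a = Real.tanh a * Real.cosh a := by
    rw [Real.tanh_eq_sinh_div_cosh, div_mul_cancel₀ _ ca.ne']
  rw [e2, e3, eq_div_iff ca.ne', Real.cosh_eq (b - a), Real.sinh_eq (b - a)]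
  ring

lemma aux_tanh_cont : Continuous Real.tanh := by
  have : Real.tanh = fun x => Real.sinh x / Real.cosh x := by
    funext x; exact Real.tanh_eq_sinh_div_cosh x
  rw [this]
  exact Real.continuous_sinh.div Real.continuous_cosh (fun x => (Real.cosh_pos x).ne')

lemma stdPdf_pos (x : ℝ) : 0 < stdPdf x := by unfold stdPdf; positivity

lemma stdPdf_cont : Continuous stdPdf := by unfold stdPdf; fun_prop

lemma stdPdf_neg (x : ℝ) : stdPdf (-x) = stdPdf x := by simp [stdPdf]

lemma stdPdf_le (x : ℝ) : stdPdf x ≤ 1 := by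
  unfold stdPdf
  have h1 : (Real.sqrt (2 * Real.pi))⁻¹ ≤ 1 := by
    apply inv_le_one_of_one_le₀
    rw [Real.one_le_sqrt]
    have := Real.pi_gt_three
    linarith
  have h2 : Real.exp (-x ^ 2 / 2) ≤ 1 := by
    rw [Real.exp_le_one_iff]; nlinarith [sq_nonneg x]
  exact mul_le_one₀ h1 (Real.exp_pos _).le h2

lemma stdPdf_eq (a x : ℝ) : stdPdf (x - a) = ProbabilityTheory.gaussianPDFReal a 1 x := by
  simp [stdPdf, ProbabilityTheory.gaussianPDFReal]

lemma int_stdPdf (a : ℝ) : ∫ x, stdPdf (x - a) = 1 := by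
  simp_rw [stdPdf_eq]
  exact ProbabilityTheory.integral_gaussianPDFReal_eq_one a one_ne_zero

lemma int_x_stdPdf (a : ℝ) : ∫ x, x * stdPdf (x - a) = a := by
  have := ProbabilityTheory.integral_gaussianReal_eq_integral_smul (μ := a) (v := 1)
    (f := fun x : ℝ => x) one_ne_zero
  rw [ProbabilityTheory.integral_id_gaussianReal] at this
  simp_rw [stdPdf_eq]
  simp only [smul_eq_mul] at this
  refine Eq.trans ?_ this.symm
  congr 1; funext x; ring

lemma int_x2_stdPdf : ∫ x, x ^ 2 * stdPdf x = 1 := by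
  have := ProbabilityTheory.integral_gaussianReal_eq_integral_smul (μ := 0) (v := 1)
    (f := fun x : ℝ => x ^ 2) one_ne_zero
  have h2 := ProbabilityTheory.variance_fun_id_gaussianReal (μ := 0) (v := 1)
  rw [ProbabilityTheory.variance_eq_integral (by fun_prop)] at h2
  simp only [ProbabilityTheory.integral_id_gaussianReal, sub_zero] at h2
  rw [h2] at this
  have e : ∀ x, stdPdf x = ProbabilityTheory.gaussianPDFReal 0 1 x := fun x => by
    rw [← stdPdf_eq, sub_zero]
  simp_rw [e]
  simp only [smul_eq_mul] at this
  refine Eq.trans ?_ (this.symm.trans (by norm_num))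
  congr 1; funext x; ring

lemma integrable_dom0 : Integrable (fun x : ℝ => (1 + x ^ 2) * stdPdf x) := by
  have h1 := integrable_exp_neg_mul_sq (b := 1 / 2) (by norm_num)
  have h2 := integrable_rpow_mul_exp_neg_mul_sq (b := 1 / 2) (by norm_num) (s := 2) (by norm_num)
  have := (h1.add h2).const_mul ((Real.sqrt (2 * Real.pi))⁻¹)
  refine this.congr (Filter.Eventually.of_forall fun x => ?_)
  simp only [Pi.add_apply, stdPdf, Real.rpow_two]
  rw [show -x ^ 2 / 2 = -(1 / 2) * x ^ 2 by ring]
  ring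

lemma integrable_dom {F : ℝ → ℝ} (hF : Continuous F) (C : ℝ) (h : ∀ x, |F x| ≤ C * (1 + x ^ 2))
    (a : ℝ) : Integrable (fun x => F x * stdPdf (x - a)) := by
  have h0 := (integrable_dom0.comp_sub_right a).const_mul (C * (2 + 2 * a ^ 2))
  have hC : 0 ≤ C := by have := (abs_nonneg _).trans (h 0); simpa using this
  refine h0.mono' ((hF.mul (stdPdf_cont.comp (by fun_prop))).aestronglyMeasurable)
    (Filter.Eventually.of_forall fun x => ?_)
  rw [Real.norm_eq_abs, abs_mul, abs_of_pos (stdPdf_pos _), ← mul_assoc]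
  have hp := (stdPdf_pos (x - a)).le
  gcongr
  refine (h x).trans ?_
  rw [mul_assoc]
  gcongr
  nlinarith [sq_nonneg (x - 2 * a), sq_nonneg (a * (x - a)), sq_nonneg a]

lemma gmod_eq (l x : ℝ) :
    gmod l x = stdPdf x * (Real.exp (-l ^ 2 / 2) * Real.cosh (l * x)) := by
  unfold gmod stdPdf
  rw [Real.cosh_eq]
  have e1 : Real.exp (-(x - l) ^ 2 / 2) = Real.exp (-x ^ 2 / 2) * Real.exp (-l ^ 2 / 2)
      * Real.exp (l * x) := by
    rw [← Real.exp_add, ← Real.exp_add]; congr 1; ring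
  have e2 : Real.exp (-(x + l) ^ 2 / 2) = Real.exp (-x ^ 2 / 2) * Real.exp (-l ^ 2 / 2)
      * Real.exp (-(l * x)) := by
    rw [← Real.exp_add, ← Real.exp_add]; congr 1; ring
  rw [e1, e2]; ring

lemma gmod_pos (l x : ℝ) : 0 < gmod l x := by
  have := stdPdf_pos (x - l)
  have := stdPdf_pos (x + l)
  unfold gmod; positivity

lemma gmod_cont (l : ℝ) : Continuous (gmod l) := by
  unfold gmod
  have := stdPdf_cont
  fun_prop

lemma integrable_gmod {F : ℝ → ℝ} (hF : Continuous F) (C : ℝ) (h : ∀ x, |F x| ≤ C * (1 + x ^ 2))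
    (l : ℝ) : Integrable (fun x => F x * gmod l x) := by
  have h1 := (integrable_dom hF C h l).const_mul (1 / 2)
  have h2 := (integrable_dom hF C h (-l)).const_mul (1 / 2)
  refine (h1.add h2).congr (Filter.Eventually.of_forall fun x => ?_)
  simp only [Pi.add_apply, gmod, sub_neg_eq_add]; ring

lemma int_gmod {F : ℝ → ℝ} (hF : Continuous F) (C : ℝ) (h : ∀ x, |F x| ≤ C * (1 + x ^ 2))
    (l : ℝ) : ∫ x, F x * gmod l x
      = 1 / 2 * (∫ x, F x * stdPdf (x - l)) + 1 / 2 * (∫ x, F x * stdPdf (x - -l)) := by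
  rw [← integral_const_mul, ← integral_const_mul, ← integral_add
    ((integrable_dom hF C h l).const_mul (1 / 2)) ((integrable_dom hF C h (-l)).const_mul (1 / 2))]
  congr 1; funext x
  simp only [gmod, sub_neg_eq_add]; ring

lemma int_even {F : ℝ → ℝ} (he : ∀ x, F (-x) = F x) (l : ℝ) :
    ∫ x, F x * stdPdf (x - -l) = ∫ x, F x * stdPdf (x - l) := by
  rw [← integral_neg_eq_self]
  congr 1; funext x
  rw [he, ← stdPdf_neg]; congr 2; ring

lemma xtanh_cont (θ : ℝ) : Continuous (fun x : ℝ => x * Real.tanh (θ * x)) := by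
  have := aux_tanh_cont
  fun_prop

lemma xtanh_bd (θ x : ℝ) : |x * Real.tanh (θ * x)| ≤ 1 * (1 + x ^ 2) := by
  rw [abs_mul]
  have h1 := (Real.abs_tanh_lt_one (θ * x)).le
  have h2 := abs_nonneg x
  have h3 : |x| * |Real.tanh (θ * x)| ≤ |x| * 1 := by gcongr
  nlinarith [sq_abs x, sq_nonneg (|x| - 1)]

def AA (l θ : ℝ) : ℝ := ∫ x, x * Real.tanh (θ * x) * stdPdf (x - l)

lemma AA_neg_l (l θ : ℝ) : AA (-l) θ = AA l θ :=
  int_even (F := fun x => x * Real.tanh (θ * x)) (fun x => aux_xtanh_even θ x) l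

lemma AA_neg (l θ : ℝ) : AA l (-θ) = -AA l θ := by
  unfold AA
  rw [← integral_neg]
  congr 1; funext x
  rw [neg_mul, Real.tanh_neg]; ring

lemma AA_eq (l θ : ℝ) : AA l θ = ∫ x, x * Real.tanh (θ * x) * gmod l x := by
  rw [int_gmod (xtanh_cont θ) 1 (xtanh_bd θ) l]
  have := AA_neg_l l θ
  unfold AA at *
  rw [this]; ring

lemma AA_int (l θ : ℝ) : Integrable (fun x => x * Real.tanh (θ * x) * gmod l x) :=
  integrable_gmod (xtanh_cont θ) 1 (xtanh_bd θ) l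

lemma AA_self (l : ℝ) : AA l l = l := by
  rw [AA_eq]
  have hx : ∀ x : ℝ, |x| ≤ 1 * (1 + x ^ 2) := fun x => by
    nlinarith [sq_abs x, sq_nonneg (|x| - 1)]
  have e : ∀ x, x * Real.tanh (l * x) * gmod l x
      = 1 / 2 * (x * stdPdf (x - l)) - 1 / 2 * (x * stdPdf (x - -l)) := by
    intro x
    have h1 : 1 / 2 * (x * stdPdf (x - l)) - 1 / 2 * (x * stdPdf (x - -l))
        = x * (stdPdf x * (Real.exp (-l ^ 2 / 2) * Real.sinh (l * x))) := by
      unfold stdPdf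
      rw [Real.sinh_eq]
      have e1 : Real.exp (-(x - l) ^ 2 / 2) = Real.exp (-x ^ 2 / 2) * Real.exp (-l ^ 2 / 2)
          * Real.exp (l * x) := by
        rw [← Real.exp_add, ← Real.exp_add]; congr 1; ring
      have e2 : Real.exp (-(x - -l) ^ 2 / 2) = Real.exp (-x ^ 2 / 2) * Real.exp (-l ^ 2 / 2)
          * Real.exp (-(l * x)) := by
        rw [← Real.exp_add, ← Real.exp_add]; congr 1; ring
      rw [e1, e2]; ring
    rw [h1, gmod_eq, Real.tanh_eq_sinh_div_cosh]
    have := (Real.cosh_pos (l * x)).ne'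
    field_simp
  simp_rw [e]
  have i1 : ∀ a, Integrable (fun x : ℝ => x * stdPdf (x - a)) :=
    fun a => integrable_dom continuous_id 1 hx a
  rw [integral_sub ((i1 l).const_mul _) ((i1 (-l)).const_mul _), integral_const_mul,
    integral_const_mul, int_x_stdPdf, int_x_stdPdf]
  ring

lemma AA_mono (l : ℝ) {a b : ℝ} (h : a ≤ b) : AA l a ≤ AA l b := by
  rw [AA_eq, AA_eq]
  refine integral_mono (AA_int l a) (AA_int l b) fun x => ?_
  have := (gmod_pos l x).le
  have := aux_pt_mono h x
  dsimp only
  gcongr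

lemma AA_contr {l a b : ℝ} (ha : 0 ≤ a) (h : a ≤ b) (hl : l ^ 2 ≤ 2 * a ^ 2) :
    AA l b - AA l a ≤ Real.exp (-l ^ 2 / 2) * (b - a) := by
  rw [AA_eq, AA_eq, ← integral_sub (AA_int l b) (AA_int l a)]
  have hi : Integrable (fun x : ℝ => x ^ 2 * stdPdf x) := by
    have := integrable_dom (F := fun x => x ^ 2) (by fun_prop) 1
      (fun x => by rw [abs_of_nonneg (sq_nonneg x)]; linarith) 0
    simpa using this
  have e : Real.exp (-l ^ 2 / 2) * (b - a)
      = ∫ x, (Real.exp (-l ^ 2 / 2) * (b - a)) * (x ^ 2 * stdPdf x) := by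
    rw [integral_const_mul, int_x2_stdPdf, mul_one]
  rw [e]
  refine integral_mono ((AA_int l b).sub (AA_int l a)) (hi.const_mul _) fun x => ?_
  dsimp only
  rw [← sub_mul]
  have hg := (gmod_pos l x).le
  have h1 := aux_pt_sub ha h x
  have h2 := aux_cosh_le hl x
  have cp := Real.cosh_pos (a * x)
  have sp := (stdPdf_pos x).le
  have hba := sub_nonneg.2 h
  calc (x * Real.tanh (b * x) - x * Real.tanh (a * x)) * gmod l x
      ≤ ((b - a) * x ^ 2 / Real.cosh (a * x) ^ 2) * gmod l x := by gcongr
    _ = (Real.exp (-l ^ 2 / 2) * (b - a)) * (x ^ 2 * stdPdf x) *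
        (Real.cosh (l * x) / Real.cosh (a * x) ^ 2) := by rw [gmod_eq]; ring
    _ ≤ (Real.exp (-l ^ 2 / 2) * (b - a)) * (x ^ 2 * stdPdf x) * 1 := by
        gcongr
        exact (div_le_one (by positivity)).2 h2
    _ = _ := mul_one _

lemma AA_ratio (l : ℝ) {a b : ℝ} (ha : 0 ≤ a) (h : a ≤ b) : a * AA l b ≤ b * AA l a := by
  rw [AA_eq, AA_eq, ← integral_const_mul, ← integral_const_mul]
  refine integral_mono ((AA_int l b).const_mul _) ((AA_int l a).const_mul _) fun x => ?_
  dsimp only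
  have := mul_le_mul_of_nonneg_right (aux_pt_ratio ha h x) (gmod_pos l x).le
  linarith

lemma AA_gt {l θ : ℝ} (h0 : 0 < θ) (h : θ < l) : θ < AA l θ := by
  have hl : 0 < l := h0.trans h
  obtain ⟨t, h1, h2, h3⟩ : ∃ t, θ ≤ t ∧ 3 / 4 * l ≤ t ∧ t < l :=
    ⟨max θ (3 / 4 * l), le_max_left _ _, le_max_right _ _, max_lt h (by linarith)⟩
  have ht : 0 < t := h0.trans_le h1
  have hc := AA_contr (l := l) ht.le h3.le (by nlinarith)
  rw [AA_self] at hc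
  have he : Real.exp (-l ^ 2 / 2) < 1 := by rw [Real.exp_lt_one_iff]; nlinarith
  have h4 : t < AA l t := by nlinarith
  have h5 := AA_ratio l h0.le h1
  nlinarith

lemma gstar_pos (s ρ x : ℝ) : 0 < gstar s ρ x := by
  have := stdPdf_pos (x - s * (-ρ - 1))
  have := stdPdf_pos (x - s)
  have := stdPdf_pos (x - s * (ρ - 1))
  unfold gstar; positivity

lemma gstar_cont (s ρ : ℝ) : Continuous (gstar s ρ) := by
  unfold gstar
  have := stdPdf_cont
  fun_prop

lemma gstar_int {F : ℝ → ℝ} (hF : Continuous F) (C : ℝ) (h : ∀ x, |F x| ≤ C * (1 + x ^ 2))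
    (s ρ : ℝ) : Integrable (fun x => F x * gstar s ρ x) ∧ ∫ x, F x * gstar s ρ x
      = 1 / 4 * (∫ x, F x * stdPdf (x - s * (-ρ - 1))) + 1 / 2 * (∫ x, F x * stdPdf (x - s))
        + 1 / 4 * (∫ x, F x * stdPdf (x - s * (ρ - 1))) := by
  have h1 := (integrable_dom hF C h (s * (-ρ - 1))).const_mul (1 / 4)
  have h2 := (integrable_dom hF C h s).const_mul (1 / 2)
  have h3 := (integrable_dom hF C h (s * (ρ - 1))).const_mul (1 / 4)
  have e : ∀ x, F x * gstar s ρ x = 1 / 4 * (F x * stdPdf (x - s * (-ρ - 1)))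
      + 1 / 2 * (F x * stdPdf (x - s)) + 1 / 4 * (F x * stdPdf (x - s * (ρ - 1))) := by
    intro x; unfold gstar; ring
  simp_rw [e]
  refine ⟨(h1.add h2).add h3, ?_⟩
  have e2 := integral_add (h1.add h2) h3
  simp only [Pi.add_apply] at e2
  rw [e2, integral_add h1 h2]
  simp only [integral_const_mul]

lemma Mpop_eq' (s ρ θ : ℝ) : Mpop s ρ θ = ∫ x, x * Real.tanh (θ * x) * gstar s ρ x := by
  unfold Mpop gstarMeasure
  rw [integral_withDensity_eq_integral_toReal_smul
    ((gstar_cont s ρ).measurable.ennreal_ofReal)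
    (Filter.Eventually.of_forall fun x => ENNReal.ofReal_lt_top)]
  congr 1; funext x
  rw [ENNReal.toReal_ofReal (gstar_pos s ρ x).le, smul_eq_mul, mul_comm]

lemma Mpop_eq (s ρ θ : ℝ) : Mpop s ρ θ
    = 1 / 4 * AA (|s| * (1 + ρ)) θ + 1 / 2 * AA |s| θ + 1 / 4 * AA (|s| * (1 - ρ)) θ := by
  rw [Mpop_eq', (gstar_int (xtanh_cont θ) 1 (xtanh_bd θ) s ρ).2]
  change 1 / 4 * AA (s * (-ρ - 1)) θ + 1 / 2 * AA s θ + 1 / 4 * AA (s * (ρ - 1)) θ = _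
  rcases abs_cases s with ⟨h, _⟩ | ⟨h, _⟩ <;> rw [h]
  · rw [← AA_neg_l (s * (-ρ - 1)), ← AA_neg_l (s * (ρ - 1))]
    congr 3
    · congr 2; ring
    · congr 1; ring
  · rw [AA_neg_l, show s * (-ρ - 1) = -s * (1 + ρ) by ring, show s * (ρ - 1) = -s * (1 - ρ) by ring]

lemma log_int {f : ℝ → ℝ} (hf : Continuous f) {c a : ℝ} (hc : 0 < c)
    (h1 : ∀ x, c * stdPdf (x - a) ≤ f x) (h2 : ∀ x, f x ≤ 1) (s ρ : ℝ) :
    Integrable (fun x => Real.log (f x) * gstar s ρ x) := by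
  have hp : ∀ x, 0 < f x := fun x => (mul_pos hc (stdPdf_pos _)).trans_le (h1 x)
  set K := |Real.log (c * (Real.sqrt (2 * Real.pi))⁻¹)| with hK
  have hK0 : 0 ≤ K := abs_nonneg _
  refine (gstar_int (hf.log fun x => (hp x).ne') (K + 1 + a ^ 2) (fun x => ?_) s ρ).1
  rw [abs_of_nonpos (Real.log_nonpos (hp x).le (h2 x))]
  have h3 := Real.log_le_log (mul_pos hc (stdPdf_pos (x - a))) (h1 x)
  have h4 : Real.log (c * stdPdf (x - a))
      = Real.log (c * (Real.sqrt (2 * Real.pi))⁻¹) + (-(x - a) ^ 2 / 2) := by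
    unfold stdPdf
    rw [← mul_assoc, Real.log_mul (by positivity) (Real.exp_pos _).ne', Real.log_exp]
  have h5 : -K ≤ Real.log (c * (Real.sqrt (2 * Real.pi))⁻¹) := neg_abs_le _
  nlinarith [sq_nonneg (x + a), mul_nonneg hK0 (sq_nonneg x), sq_nonneg (a * x)]

lemma klg_int (s ρ θ : ℝ) :
    Integrable (fun x => gstar s ρ x * Real.log (gstar s ρ x / gmod θ x)) := by
  have h1 : Integrable (fun x => Real.log (gstar s ρ x) * gstar s ρ x) := by
    refine log_int (gstar_cont s ρ) (c := 1 / 2) (a := s) (by norm_num) (fun x => ?_)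
      (fun x => ?_) s ρ
    · have := stdPdf_pos (x - s * (-ρ - 1))
      have := stdPdf_pos (x - s * (ρ - 1))
      unfold gstar; linarith
    · have := stdPdf_le (x - s * (-ρ - 1))
      have := stdPdf_le (x - s)
      have := stdPdf_le (x - s * (ρ - 1))
      unfold gstar; linarith
  have h2 : Integrable (fun x => Real.log (gmod θ x) * gstar s ρ x) := by
    refine log_int (gmod_cont θ) (c := 1 / 2) (a := θ) (by norm_num) (fun x => ?_)
      (fun x => ?_) s ρ
    · have := stdPdf_pos (x + θ)
      unfold gmod; linarith
    · have := stdPdf_le (x + θ)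
      have := stdPdf_le (x - θ)
      unfold gmod; linarith
  refine (h1.sub h2).congr (Filter.Eventually.of_forall fun x => ?_)
  simp only [Pi.sub_apply]
  rw [Real.log_div (gstar_pos s ρ x).ne' (gmod_pos θ x).ne']
  ring

lemma int_gstar (s ρ : ℝ) : Integrable (gstar s ρ) ∧ ∫ x, gstar s ρ x = 1 := by
  have := gstar_int (F := fun _ => 1) continuous_const 1
    (fun x => by rw [abs_one]; nlinarith [sq_nonneg x]) s ρ
  simp only [one_mul, int_stdPdf] at this
  refine ⟨this.1, this.2.trans (by norm_num)⟩

lemma klg_sub (s ρ θ t : ℝ) :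
    klg s ρ t - klg s ρ θ ≤ (t ^ 2 - θ ^ 2) / 2 - (t - θ) * Mpop s ρ θ := by
  unfold klg
  rw [← integral_sub (klg_int s ρ t) (klg_int s ρ θ), Mpop_eq']
  have i1 := (gstar_int (xtanh_cont θ) 1 (xtanh_bd θ) s ρ).1
  have i0 := int_gstar s ρ
  have e : (t ^ 2 - θ ^ 2) / 2 - (t - θ) * ∫ x, x * Real.tanh (θ * x) * gstar s ρ x
      = ∫ x, ((t ^ 2 - θ ^ 2) / 2 * gstar s ρ x
        - (t - θ) * (x * Real.tanh (θ * x) * gstar s ρ x)) := by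
    rw [integral_sub (i0.1.const_mul _) (i1.const_mul _), integral_const_mul, integral_const_mul,
      i0.2, mul_one]
  rw [e]
  refine integral_mono ((klg_int s ρ t).sub (klg_int s ρ θ))
    ((i0.1.const_mul _).sub (i1.const_mul _)) fun x => ?_
  dsimp only
  have gp := gstar_pos s ρ x
  have hl : ∀ u, Real.log (gstar s ρ x / gmod u x)
      = Real.log (gstar s ρ x) - Real.log (stdPdf x) + u ^ 2 / 2 - Real.log (Real.cosh (u * x)) := by
    intro u
    rw [Real.log_div gp.ne' (gmod_pos u x).ne', gmod_eq, Real.log_mul (stdPdf_pos x).ne'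
      (mul_pos (Real.exp_pos _) (Real.cosh_pos _)).ne', Real.log_mul (Real.exp_pos _).ne'
      (Real.cosh_pos _).ne', Real.log_exp]
    ring
  rw [hl, hl]
  have := aux_logcosh (θ * x) (t * x)
  nlinarith [mul_le_mul_of_nonneg_left this gp.le]

lemma fixed_pt {s ρ θ : ℝ} (h : ∀ t, klg s ρ θ ≤ klg s ρ t) : Mpop s ρ θ = θ := by
  have h1 := klg_sub s ρ θ (Mpop s ρ θ)
  have h2 := h (Mpop s ρ θ)
  have h3 : (Mpop s ρ θ - θ) ^ 2 ≤ 0 := by nlinarith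
  have h4 : Mpop s ρ θ - θ = 0 := by
    have := le_antisymm h3 (sq_nonneg _)
    exact pow_eq_zero_iff (two_ne_zero) |>.1 this
  linarith

lemma Mpop_neg (s ρ θ : ℝ) : Mpop s ρ (-θ) = -Mpop s ρ θ := by
  rw [Mpop_eq, Mpop_eq, AA_neg, AA_neg, AA_neg]; ring

lemma Mpop_mono (s ρ : ℝ) {a b : ℝ} (h : a ≤ b) : Mpop s ρ a ≤ Mpop s ρ b := by
  rw [Mpop_eq, Mpop_eq]
  have h1 := AA_mono (|s| * (1 + ρ)) h
  have h2 := AA_mono |s| h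
  have h3 := AA_mono (|s| * (1 - ρ)) h
  linarith

lemma Mpop_contr {s ρ : ℝ} (hρ : 0 < ρ) (hρ' : ρ ≤ 1 / 100) {a b : ℝ} (ha : 0 ≤ a)
    (h : a ≤ b) (hl : (|s| * (1 + ρ)) ^ 2 ≤ 2 * a ^ 2) :
    Mpop s ρ b - Mpop s ρ a ≤ Real.exp (-(1 / 4) * s ^ 2) * (b - a) := by
  have hs := abs_nonneg s
  have key : ∀ l, 0 ≤ l → |s| * (1 - ρ) ≤ l → l ≤ |s| * (1 + ρ) →
      AA l b - AA l a ≤ Real.exp (-(1 / 4) * s ^ 2) * (b - a) := by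
    intro l hl0 h1 h2
    have h3 : l ^ 2 ≤ (|s| * (1 + ρ)) ^ 2 := by gcongr
    refine (AA_contr ha h (h3.trans hl)).trans ?_
    have hba := sub_nonneg.2 h
    gcongr
    have h4 : 99 / 100 * |s| ≤ l := by nlinarith
    have h5 : (99 / 100 * |s|) ^ 2 ≤ l ^ 2 := by gcongr
    rw [mul_pow, sq_abs] at h5
    nlinarith [sq_nonneg s]
  have k1 := key (|s| * (1 + ρ)) (by positivity) (by nlinarith) le_rfl
  have k2 := key |s| hs (by nlinarith) (by nlinarith)
  have k3 := key (|s| * (1 - ρ)) (mul_nonneg hs (by linarith)) le_rfl (by nlinarith)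
  rw [Mpop_eq, Mpop_eq]
  linarith

lemma fixed_lower {s ρ θ : ℝ} (hρ : 0 < ρ) (h0 : 0 < θ) (hf : Mpop s ρ θ = θ) :
    |s| * (1 - ρ) ≤ θ := by
  by_contra! hlt
  have hs := abs_nonneg s
  have k1 := AA_gt (l := |s| * (1 + ρ)) h0 (by nlinarith)
  have k2 := AA_gt (l := |s|) h0 (by nlinarith)
  have k3 := AA_gt (l := |s| * (1 - ρ)) h0 hlt
  rw [Mpop_eq] at hf
  linarith

lemma main_pos {s ρ m θ : ℝ} (hρ : 0 < ρ) (hρ' : ρ ≤ 1 / 100) (h0 : 0 < m)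
    (hf : Mpop s ρ m = m) (hθ : |θ - m| ≤ m / 4) :
    |Mpop s ρ θ - m| ≤ Real.exp (-(1 / 4) * s ^ 2) * |θ - m| := by
  have hs := abs_nonneg s
  have hlow := fixed_lower hρ h0 hf
  obtain ⟨hθ1, hθ2⟩ := abs_le.1 hθ
  have hbd : ∀ a, 3 / 4 * m ≤ a → (|s| * (1 + ρ)) ^ 2 ≤ 2 * a ^ 2 := by
    intro a ha
    have h1 : 99 / 100 * |s| ≤ m := by nlinarith
    have h2 : |s| * (1 + ρ) ≤ 101 / 99 * m := by nlinarith
    have h3 : (|s| * (1 + ρ)) ^ 2 ≤ (101 / 99 * m) ^ 2 := by gcongr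
    have h4 : (3 / 4 * m) ^ 2 ≤ a ^ 2 := by gcongr
    nlinarith
  rcases le_total θ m with h | h
  · have k1 := Mpop_contr (s := s) hρ hρ' (by linarith) h (hbd θ (by linarith))
    have k2 := Mpop_mono s ρ h
    rw [hf] at k1 k2
    rw [abs_of_nonpos (by linarith), abs_of_nonpos (by linarith)]
    linarith
  · have k1 := Mpop_contr (s := s) hρ hρ' h0.le h (hbd m (by linarith))
    have k2 := Mpop_mono s ρ h
    rw [hf] at k1 k2
    rw [abs_of_nonneg (by linarith), abs_of_nonneg (by linarith)]
    linarith


/-- Contraction of the population EM operator toward the KL-projection `θ̄` on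
`B(θ̄, |θ̄|/4)`: there exist a universal constant `c′ > 0` and a threshold `ρ₀ > 0` such
that for every `0 < ρ ≤ ρ₀` and every minimizer `θ̄` of `θ ↦ KL(g* ‖ g_θ)`, for all
`θ ∈ B(θ̄, |θ̄|/4)`, `|M(θ) − θ̄| ≤ γ |θ − θ̄|` where `γ = e^{−c′ ξ²}`, `ξ = |θ*|`. -/
theorem population_em_contraction :
    ∃ c' > (0 : ℝ), ∃ ρ₀ > (0 : ℝ), ∀ θs : ℝ, θs ≠ 0 →
      ∀ ρ : ℝ, 0 < ρ → ρ ≤ ρ₀ →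
        ∀ θbar : ℝ, (∀ θ, klg θs ρ θbar ≤ klg θs ρ θ) →
          ∀ θ ∈ Metric.closedBall θbar (|θbar| / 4),
            |Mpop θs ρ θ - θbar| ≤ Real.exp (-c' * θs ^ 2) * |θ - θbar| := by
  refine ⟨1 / 4, by norm_num, 1 / 100, by norm_num, ?_⟩
  intro s _ ρ hρ hρ' m hm θ hθ
  have hf := fixed_pt hm
  rw [Metric.mem_closedBall, Real.dist_eq] at hθ
  rcases lt_trichotomy m 0 with h | h | h
  · rw [abs_of_neg h] at hθ
    have e1 : |-θ - -m| = |θ - m| := by rw [← abs_neg]; congr 1; ring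
    have := main_pos (s := s) (m := -m) (θ := -θ) hρ hρ' (by linarith)
      (by rw [Mpop_neg, hf]) (by rw [e1]; exact hθ)
    rw [e1, Mpop_neg] at this
    have e2 : |-Mpop s ρ θ - -m| = |Mpop s ρ θ - m| := by rw [← abs_neg]; congr 1; ring
    rwa [e2] at this
  · subst h
    have : θ = 0 := by simpa using hθ
    subst this
    rw [hf]; simp
  · rw [abs_of_pos h] at hθ
    exact main_pos hρ hρ' h hf hθ

end
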